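/- (Theorem 4.) Let occ : ℤ³ → S be an occupancy map, let (a, b) ∈ ℤ², and let z₁ ≤ z₂ be integers. Assume that no voxel (a, b, z) with z₁ ≤ z ≤ z₂ is a boundary voxel. Then all voxels (a, b, z) with z₁ ≤ z ≤ z₂ have the same occupancy state, and this common state is free or unknown (in particular it is not occupied). -/

import Mathlib

inductive OccState : Type
  | free | occupied | unknown
deriving DecidableEq

abbrev Voxel := ℤ × ℤ × ℤ

/-- Two voxels are 6-neighbors iff their ℓ¹ distance is 1. -/
def sixNbr (m n : Voxel) : Prop :=
  |m.1 - n.1| + |m.2.1 - n.2.1| + |m.2.2 - n.2.2| = 1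

/-- Boundary interior voxel: free, with a 6-neighbor that is unknown or occupied. -/
def bdInt (occ : Voxel → OccState) (n : Voxel) : Prop :=
  occ n = OccState.free ∧
    ∃ m, sixNbr m n ∧ (occ m = OccState.unknown ∨ occ m = OccState.occupied)

/-- Boundary exterior (unknown) voxel: unknown, with a free 6-neighbor. -/
def bdUkn (occ : Voxel → OccState) (n : Voxel) : Prop :=
  occ n = OccState.unknown ∧ ∃ m, sixNbr m n ∧ occ m = OccState.free

/-- Boundary exterior (occupied) voxel: any occupied voxel. -/
def bdOcc (occ : Voxel → OccState) (n : Voxel) : Prop :=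
  occ n = OccState.occupied

/-- Boundary voxel. -/
def bdVoxel (occ : Voxel → OccState) (n : Voxel) : Prop :=
  bdInt occ n ∨ bdUkn occ n ∨ bdOcc occ n

/-- An axis direction: exactly one nonzero coordinate, equal to ±1 (ℓ¹ norm 1). -/
def axisDir (e : Voxel) : Prop :=
  |e.1| + |e.2.1| + |e.2.2| = 1

/-- A voxel that is not a boundary voxel has the same state as any of its 6-neighbors that is
not a boundary voxel. -/
theorem occ_eq_of_sixNbr {occ : Voxel → OccState} {m n : Voxel} (h : sixNbr m n)
    (hm : ¬ bdVoxel occ m) (hn : ¬ bdVoxel occ n) : occ m = occ n := by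
  simp only [bdVoxel, bdInt, bdUkn, bdOcc, not_or, not_and, not_exists] at hm hn
  obtain ⟨-, -, hmo⟩ := hm
  obtain ⟨hni, hnu, hno⟩ := hn
  have hi := fun hf => hni hf m h
  have hu := fun hf => hnu hf m h
  cases hm : occ m <;> cases hn : occ n <;> simp_all

theorem stmt6 (occ : Voxel → OccState) (a b : ℤ) (z₁ z₂ : ℤ) (hz : z₁ ≤ z₂)
    (hnb : ∀ z : ℤ, z₁ ≤ z → z ≤ z₂ → ¬ bdVoxel occ (a, b, z)) :
    ∃ s : OccState, (s = OccState.free ∨ s = OccState.unknown) ∧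
      ∀ z : ℤ, z₁ ≤ z → z ≤ z₂ → occ (a, b, z) = s := by
  have hconst : ∀ z : ℤ, z₁ ≤ z → z ≤ z₂ → occ (a, b, z) = occ (a, b, z₁) := by
    intro z hz₁
    induction z, hz₁ using Int.leInduction with
    | base => exact fun _ => rfl
    | succ z hz₁ ih =>
      intro hz₂
      rw [← ih (by lia)]
      exact occ_eq_of_sixNbr (by simp [sixNbr]) (hnb _ (by lia) hz₂) (hnb _ hz₁ (by lia))
  refine ⟨occ (a, b, z₁), ?_, hconst⟩
  have hocc : occ (a, b, z₁) ≠ OccState.occupied := fun h => hnb z₁ le_rfl hz (Or.inr (Or.inr h))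
  cases h : occ (a, b, z₁) <;> simp_all
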